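/- arXiv:2105.08749 — 4 statements merged into one kernel-verified Lean document; each statement's English description precedes it below -/
import Mathlib

section
/- Let 𝕜 be a field and R a commutative Noetherian local 𝕜-algebra with maximal ideal m whose residue field is 𝕜 (i.e., the composite 𝕜 → R → R/m is an isomorphism). Let t ∈ m, let F be an R-module on which t acts as a nonzerodivisor, and let A ⊆ P ⊆ F be submodules such that P/A has finite length over R and for every p ∈ P there exists s ≥ 0 with t^s·p ∈ A. Then the 𝕜-vector spaces P/(A + t·P) and (t·P ∩ A)/t·A are finite-dimensional of the same dimension over 𝕜 (they are isomorphic as 𝕜-vector spaces). -/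
open Pointwise

/-- A module of finite length over a local `𝕜`-algebra with residue field `𝕜` is
finite-dimensional over `𝕜`. -/
theorem IsFiniteLength.module_finite_of_residue_surjective {𝕜 : Type*} [Field 𝕜] {R : Type*}
    [CommRing R] [IsLocalRing R] [Algebra 𝕜 R]
    (hres : Function.Surjective ((IsLocalRing.residue R).comp (algebraMap 𝕜 R)))
    {M : Type*} [AddCommGroup M] [Module R M] (hM : IsFiniteLength R M) :
    ∀ [Module 𝕜 M] [IsScalarTower 𝕜 R M], Module.Finite 𝕜 M := by
  induction hM with
  | of_subsingleton =>
    intro _ _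
    infer_instance
  | @of_simple_quotient M _ _ N hsimple _ ih =>
    intro _ _
    obtain ⟨I, hI, ⟨e⟩⟩ := isSimpleModule_iff_quot_maximal.mp hsimple
    obtain rfl := IsLocalRing.eq_maximalIdeal hI
    have hfin : Module.Finite 𝕜 (R ⧸ IsLocalRing.maximalIdeal R) :=
      Module.Finite.of_surjective
        (Algebra.linearMap 𝕜 (R ⧸ IsLocalRing.maximalIdeal R)) hres
    have hquot : Module.Finite 𝕜 (M ⧸ N) :=
      Module.Finite.equiv (e.restrictScalars 𝕜).symm
    have hsub : Module.Finite 𝕜 N := ih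
    have hquot' : Module.Finite 𝕜 (M ⧸ N.restrictScalars 𝕜) := hquot
    have hsub' : Module.Finite 𝕜 (N.restrictScalars 𝕜) := hsub
    exact Module.Finite.of_submodule_quotient (N.restrictScalars 𝕜)

/-- The cokernel and the kernel of an `R`-linear endomorphism of a finite-dimensional `𝕜`-space are
finite-dimensional and isomorphic over `𝕜`. -/
theorem LinearMap.finite_and_nonempty_equiv_of_equiv_coker_ker {𝕜 : Type*} [Field 𝕜]
    {R : Type*} [CommRing R] [Algebra 𝕜 R] {Q C K : Type*}
    [AddCommGroup Q] [Module R Q] [Module 𝕜 Q] [IsScalarTower 𝕜 R Q] [Module.Finite 𝕜 Q]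
    [AddCommGroup C] [Module R C] [Module 𝕜 C] [IsScalarTower 𝕜 R C]
    [AddCommGroup K] [Module R K] [Module 𝕜 K] [IsScalarTower 𝕜 R K]
    (f : Q →ₗ[R] Q) (eC : C ≃ₗ[R] Q ⧸ LinearMap.range f) (eK : K ≃ₗ[R] LinearMap.ker f) :
    Module.Finite 𝕜 C ∧ Module.Finite 𝕜 K ∧ Nonempty (C ≃ₗ[𝕜] K) := by
  let f' : Q →ₗ[𝕜] Q := f.restrictScalars 𝕜
  let εC : C ≃ₗ[𝕜] Q ⧸ LinearMap.range f' := eC.restrictScalars 𝕜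
  let εK : K ≃ₗ[𝕜] LinearMap.ker f' := eK.restrictScalars 𝕜
  have h₁ := (LinearMap.range f').finrank_quotient_add_finrank
  have h₂ := f'.finrank_range_add_finrank_ker
  have e : (Q ⧸ LinearMap.range f') ≃ₗ[𝕜] LinearMap.ker f' :=
    LinearEquiv.ofFinrankEq _ _ (by omega)
  exact ⟨Module.Finite.equiv εC.symm, Module.Finite.equiv εK.symm, ⟨εC ≪≫ₗ e ≪≫ₗ εK.symm⟩⟩

section TorsionQuotients

variable {R : Type*} [CommRing R] {F : Type*} [AddCommGroup F] [Module R F]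

/-- `P/(A + tP)` is the cokernel of multiplication by `t` on `P/A`. -/
theorem Submodule.nonempty_quotient_sup_smul_equiv (t : R) (A P : Submodule R F) :
    Nonempty ((P ⧸ Submodule.comap P.subtype (A ⊔ t • P)) ≃ₗ[R]
      ((P ⧸ Submodule.comap P.subtype A) ⧸
        LinearMap.range (LinearMap.lsmul R (P ⧸ Submodule.comap P.subtype A) t))) := by
  set A' := Submodule.comap P.subtype A
  let g := (LinearMap.range (LinearMap.lsmul R (P ⧸ A') t)).mkQ ∘ₗ A'.mkQ
  have hg : Function.Surjective g :=
    (Submodule.mkQ_surjective _).comp (Submodule.mkQ_surjective _)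
  refine ⟨(Submodule.quotEquivOfEq _ _ ?_).trans (g.quotKerEquivOfSurjective hg)⟩
  ext p
  simp only [g, LinearMap.mem_ker, LinearMap.comp_apply, Submodule.mkQ_apply,
    Submodule.Quotient.mk_eq_zero, LinearMap.mem_range, LinearMap.lsmul_apply,
    Submodule.mem_comap, Submodule.subtype_apply, Submodule.mem_sup,
    Submodule.mem_smul_pointwise_iff_exists]
  constructor
  · rintro ⟨a, ha, _, ⟨q, hq, rfl⟩, hp⟩
    refine ⟨Submodule.Quotient.mk ⟨q, hq⟩, ?_⟩
    rw [← Submodule.Quotient.mk_smul, eq_comm, Submodule.Quotient.eq]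
    have : (p : F) - t • q = a := by rw [← hp]; abel
    simpa [A', this] using ha
  · rintro ⟨y, hy⟩
    obtain ⟨q, rfl⟩ := Submodule.Quotient.mk_surjective _ y
    rw [← Submodule.Quotient.mk_smul, eq_comm, Submodule.Quotient.eq] at hy
    exact ⟨p - t • q, by simpa [A'] using hy, t • q, ⟨q, q.2, rfl⟩, by abel⟩

/-- If `t` is a nonzerodivisor on `F`, then `(tP ∩ A)/tA` is the kernel of multiplication by `t`
on `P/A`. -/
theorem Submodule.nonempty_smul_inf_quotient_equiv_ker {t : R}
    (htreg : ∀ x : F, t • x = 0 → x = 0) (A P : Submodule R F) :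
    Nonempty ((↥(t • P ⊓ A) ⧸ Submodule.comap (t • P ⊓ A).subtype (t • A)) ≃ₗ[R]
      LinearMap.ker (LinearMap.lsmul R (P ⧸ Submodule.comap P.subtype A) t)) := by
  set A' := Submodule.comap P.subtype A
  set B := Submodule.comap (t • P ⊓ A).subtype (t • A)
  let N : Submodule R P := A.comap (t • P.subtype)
  let μ : N →ₗ[R] ↥(t • P ⊓ A) := (t • P.subtype ∘ₗ N.subtype).codRestrict _ fun p =>
    ⟨Submodule.smul_mem_pointwise_smul _ t P p.1.2, p.2⟩
  let g := B.mkQ ∘ₗ μ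
  let h := A'.mkQ ∘ₗ N.subtype
  have hg : Function.Surjective g := by
    refine (Submodule.mkQ_surjective _).comp ?_
    rintro ⟨x, hx, hxA⟩
    obtain ⟨p, hp, rfl⟩ := (Submodule.mem_smul_pointwise_iff_exists _ _ _).mp hx
    exact ⟨⟨⟨p, hp⟩, hxA⟩, rfl⟩
  have hker : LinearMap.ker g = LinearMap.ker h := by
    ext p
    simp only [g, h, LinearMap.mem_ker, LinearMap.comp_apply, Submodule.mkQ_apply,
      Submodule.Quotient.mk_eq_zero]
    change t • (p : F) ∈ t • A ↔ (p : F) ∈ A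
    refine ⟨fun hp => ?_, fun hp => Submodule.smul_mem_pointwise_smul _ t A hp⟩
    obtain ⟨a, ha, hap⟩ := (Submodule.mem_smul_pointwise_iff_exists _ _ _).mp hp
    have : a - p = 0 := htreg _ (by rw [smul_sub, hap, sub_self])
    rwa [← sub_eq_zero.mp this]
  have hrange : LinearMap.range h = LinearMap.ker (LinearMap.lsmul R (P ⧸ A') t) := by
    ext y
    obtain ⟨p, rfl⟩ := Submodule.Quotient.mk_surjective _ y
    rw [LinearMap.mem_ker, LinearMap.lsmul_apply, ← Submodule.Quotient.mk_smul,
      Submodule.Quotient.mk_eq_zero]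
    change _ ↔ t • (p : F) ∈ A
    constructor
    · rintro ⟨q, hq⟩
      have hqp : (q : F) - p ∈ A := (Submodule.Quotient.eq A').mp hq
      have hqA : t • (q : F) ∈ A := q.2
      have := A.sub_mem hqA (A.smul_mem t hqp)
      rwa [← smul_sub, sub_sub_cancel] at this
    · exact fun hp => ⟨⟨p, hp⟩, rfl⟩
  exact ⟨(g.quotKerEquivOfSurjective hg).symm ≪≫ₗ Submodule.quotEquivOfEq _ _ hker ≪≫ₗ
    h.quotKerEquivRange ≪≫ₗ LinearEquiv.ofEq _ _ hrange⟩

/-- The image of `P` in `F/A` is `P/A`. -/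
theorem Submodule.nonempty_quotient_comap_subtype_equiv_map_mkQ (A P : Submodule R F) :
    Nonempty ((P ⧸ Submodule.comap P.subtype A) ≃ₗ[R] P.map A.mkQ) := by
  have hsurj := A.mkQ.submoduleMap_surjective P
  refine ⟨(Submodule.quotEquivOfEq _ _ ?_).trans (LinearMap.quotKerEquivOfSurjective _ hsurj)⟩
  ext p
  simp [LinearMap.mem_ker, Subtype.ext_iff]

end TorsionQuotients

/-- Proposition 4.3 (Key Isomorphism): for a Noetherian local `𝕜`-algebra `R` with residue
field `𝕜`, `t ∈ m`, `F` an `R`-module with `t` a nonzerodivisor on `F`, and submodules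
`A ⊆ P ⊆ F` with `P/A` of finite length and `P` in the `t`-saturation of `A`, the
`𝕜`-vector spaces `P/(A + tP)` and `(tP ∩ A)/tA` are finite-dimensional and isomorphic. -/
theorem key_isomorphism {𝕜 : Type*} [Field 𝕜] {R : Type*} [CommRing R]
    [IsNoetherianRing R] [IsLocalRing R] [Algebra 𝕜 R]
    (hres : Function.Bijective ((IsLocalRing.residue R).comp (algebraMap 𝕜 R)))
    {t : R} (ht : t ∈ IsLocalRing.maximalIdeal R)
    {F : Type*} [AddCommGroup F] [Module R F]
    (htreg : ∀ x : F, t • x = 0 → x = 0)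
    (A P : Submodule R F) (hAP : A ≤ P)
    (hlen : IsFiniteLength R ↥(P.map A.mkQ))
    (hsat : ∀ p ∈ P, ∃ s : ℕ, t ^ s • p ∈ A) :
    Module.Finite 𝕜
      (RestrictScalars 𝕜 R (↥P ⧸ Submodule.comap P.subtype (A ⊔ t • P))) ∧
    Module.Finite 𝕜
      (RestrictScalars 𝕜 R (↥(t • P ⊓ A) ⧸ Submodule.comap (t • P ⊓ A).subtype (t • A))) ∧
    Nonempty
      ((RestrictScalars 𝕜 R (↥P ⧸ Submodule.comap P.subtype (A ⊔ t • P))) ≃ₗ[𝕜]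
        (RestrictScalars 𝕜 R (↥(t • P ⊓ A) ⧸ Submodule.comap (t • P ⊓ A).subtype (t • A)))) := by
  obtain ⟨eQ⟩ := Submodule.nonempty_quotient_comap_subtype_equiv_map_mkQ A P
  obtain ⟨eC⟩ := Submodule.nonempty_quotient_sup_smul_equiv t A P
  obtain ⟨eK⟩ := Submodule.nonempty_smul_inf_quotient_equiv_ker htreg A P
  let C := P ⧸ Submodule.comap P.subtype (A ⊔ t • P)
  let K := ↥(t • P ⊓ A) ⧸ Submodule.comap (t • P ⊓ A).subtype (t • A)
  let Q := P ⧸ Submodule.comap P.subtype A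
  let : Module 𝕜 C := Module.compHom C (algebraMap 𝕜 R)
  let : Module 𝕜 K := Module.compHom K (algebraMap 𝕜 R)
  let : Module 𝕜 Q := Module.compHom Q (algebraMap 𝕜 R)
  have : IsScalarTower 𝕜 R C := IsScalarTower.of_algebraMap_smul fun _ _ => rfl
  have : IsScalarTower 𝕜 R K := IsScalarTower.of_algebraMap_smul fun _ _ => rfl
  have : IsScalarTower 𝕜 R Q := IsScalarTower.of_algebraMap_smul fun _ _ => rfl
  have hQ : IsFiniteLength R Q := eQ.symm.isFiniteLength hlen
  have hfin : Module.Finite 𝕜 Q := hQ.module_finite_of_residue_surjective hres.surjective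
  have key : Module.Finite 𝕜 C ∧ Module.Finite 𝕜 K ∧ Nonempty (C ≃ₗ[𝕜] K) :=
    LinearMap.finite_and_nonempty_equiv_of_equiv_coker_ker (LinearMap.lsmul R Q t) eC eK
  exact key
end

section
/- Let R be a commutative ring, I an ideal of R, B an R-module, and t ∈ R a nonzerodivisor on B such that there exists z ∈ I which is a nonzerodivisor on B/t·B. Let A ⊆ B be a submodule and let P := {b ∈ B : I^i·b ⊆ A for some i ≥ 0} be the I-saturation of A in B. Then {a ∈ A : I^i·a ⊆ t·A for some i ≥ 0} = (t·P) ∩ A. -/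
open Pointwise

/-- Proposition 4.4 (the ideal of the residual scheme): with `P` the `I`-saturation of `A`
in `B`, `t` a nonzerodivisor on `B` and `z ∈ I` a nonzerodivisor on `B/tB`, the
`I`-saturation of `t·A` inside `A` equals `(t·P) ∩ A`. -/
theorem residual_ideal_saturation {R : Type*} [CommRing R] (I : Ideal R)
    {B : Type*} [AddCommGroup B] [Module R B] (t : R)
    (htreg : ∀ b : B, t • b = 0 → b = 0)
    (hz : ∃ z ∈ I, ∀ b : B ⧸ (t • (⊤ : Submodule R B)), z • b = 0 → b = 0)
    (A : Submodule R B) :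
    {a : B | a ∈ A ∧ ∃ i : ℕ, ∀ c ∈ I ^ i, c • a ∈ t • A} =
      {x : B | x ∈ A ∧ ∃ p : B, (∃ i : ℕ, ∀ c ∈ I ^ i, c • p ∈ A) ∧ x = t • p} := by
  obtain ⟨z, hzI, hz⟩ := hz
  have hpow : ∀ (i : ℕ) (b : B ⧸ (t • (⊤ : Submodule R B))), z ^ i • b = 0 → b = 0 := by
    intro i
    induction i with
    | zero => intro b hb; simpa using hb
    | succ i ih =>
      intro b hb
      rw [pow_succ, mul_smul] at hb
      exact hz b (ih _ hb)
  ext a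
  constructor
  · rintro ⟨ha, i, hi⟩
    have hmem : a ∈ t • (⊤ : Submodule R B) := by
      rw [← Submodule.Quotient.mk_eq_zero]
      apply hpow i
      rw [← Submodule.Quotient.mk_smul, Submodule.Quotient.mk_eq_zero]
      obtain ⟨a', -, h⟩ := (Submodule.mem_smul_pointwise_iff_exists _ _ _).1
        (hi _ (Ideal.pow_mem_pow hzI i))
      exact (Submodule.mem_smul_pointwise_iff_exists _ _ _).2 ⟨a', trivial, h⟩
    obtain ⟨p, -, rfl⟩ := (Submodule.mem_smul_pointwise_iff_exists _ _ _).1 hmem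
    refine ⟨ha, p, ⟨i, fun c hc => ?_⟩, rfl⟩
    obtain ⟨a', ha', h⟩ := (Submodule.mem_smul_pointwise_iff_exists _ _ _).1 (hi c hc)
    have hcp : c • p = a' := by
      rw [← sub_eq_zero]
      apply htreg
      rw [smul_sub, h, smul_comm t c p, sub_self]
    rwa [hcp]
  · rintro ⟨ha, p, ⟨i, hi⟩, rfl⟩
    refine ⟨ha, i, fun c hc => ?_⟩
    rw [smul_comm c t p]
    exact Submodule.smul_mem_pointwise_smul _ _ _ (hi c hc)
end

section
/- Let K be a field and S = ⊕_{n≥0} S_n a commutative ℕ-graded ring which is a graded K-algebra (each S_n a K-subspace). Let I_V and I_W be homogeneous ideals of S with I_V ∩ I_W = 0, and let r ≥ 1 be an integer. Assume: (a) each graded piece (S/I_V)_n is a finite-dimensional K-vector space; (b) lim_{n→∞} (r!/n^r)·dim_K (S/(I_V + I_W))_n = 0; and (c) lim_{n→∞} (r!/n^r)·dim_K (S/I_V)_n = d for some real number d. Then each graded piece (I_W)_n = I_W ∩ S_n is a finite-dimensional K-vector space and lim_{n→∞} (r!/n^r)·dim_K (I_W)_n = d. -/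
open Filter

/-- If `V ⊓ W = ⊥` and the trace of `V ⊔ W` on `A` is generated by the traces of `V` and `W`, then
`W ⊓ A` embeds into the image of `A` modulo `V`, with cokernel the image of `A` modulo `V ⊔ W`. -/
theorem Submodule.finite_inf_and_finrank_map_eq {K E F G : Type*} [Field K]
    [AddCommGroup E] [Module K E] [AddCommGroup F] [Module K F] [AddCommGroup G] [Module K G]
    {V W A : Submodule K E} (f : E →ₗ[K] F) (h : F →ₗ[K] G)
    (hf : LinearMap.ker f = V) (hg : LinearMap.ker (h ∘ₗ f) = V ⊔ W)
    (hdisj : V ⊓ W = ⊥) (hA : (V ⊔ W) ⊓ A ≤ V ⊔ W ⊓ A) [Module.Finite K (A.map f)] :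
    Module.Finite K ↥(W ⊓ A) ∧
      Module.finrank K (A.map f) =
        Module.finrank K (A.map (h ∘ₗ f)) + Module.finrank K ↥(W ⊓ A) := by
  have hinj : Function.Injective (f.domRestrict (W ⊓ A)) := by
    rw [← LinearMap.ker_eq_bot, LinearMap.ker_eq_bot']
    rintro ⟨x, hxW, hxA⟩ hx
    have hxV : x ∈ V := by rw [← hf]; exact hx
    have : x ∈ V ⊓ W := ⟨hxV, hxW⟩
    rw [hdisj, Submodule.mem_bot] at this
    exact Subtype.ext this
  let e : ↥(W ⊓ A) ≃ₗ[K] ↥((W ⊓ A).map f) :=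
    (LinearEquiv.ofInjective _ hinj).trans
      (LinearEquiv.ofEq _ _ (LinearMap.range_domRestrict _ _))
  have hle : (W ⊓ A).map f ≤ A.map f := Submodule.map_mono inf_le_right
  have hfin : Module.Finite K ↥((W ⊓ A).map f) := Submodule.finiteDimensional_of_le hle
  refine ⟨Module.Finite.equiv e.symm, ?_⟩
  have hrange : LinearMap.range (h.domRestrict (A.map f)) = A.map (h ∘ₗ f) := by
    rw [LinearMap.range_domRestrict, Submodule.map_comp]
  have hker : (LinearMap.ker (h.domRestrict (A.map f))).map (A.map f).subtype =
      (W ⊓ A).map f := by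
    ext y
    constructor
    · rintro ⟨⟨_, x, hxA, rfl⟩, hx, rfl⟩
      have hx' : x ∈ (V ⊔ W) ⊓ A := ⟨by rw [← hg]; exact hx, hxA⟩
      obtain ⟨v, hv, w, hw, rfl⟩ := Submodule.mem_sup.mp (hA hx')
      refine ⟨w, hw, ?_⟩
      have : f v = 0 := by rw [← hf] at hv; exact hv
      simp [this]
    · rintro ⟨x, hx, rfl⟩
      have hx0 : x ∈ LinearMap.ker (h ∘ₗ f) := by
        rw [hg]; exact Submodule.mem_sup_right hx.1
      exact ⟨⟨f x, Submodule.mem_map_of_mem hx.2⟩, hx0, rfl⟩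
  rw [← LinearMap.finrank_range_add_finrank_ker (h.domRestrict (A.map f)), hrange,
    e.finrank_eq, ← hker, Submodule.finrank_map_subtype_eq]

/-- A homogeneous element of a sum of homogeneous ideals is a sum of an element of the first ideal
and a homogeneous element of the second. -/
theorem Ideal.IsHomogeneous.sup_inf_le {K S : Type*} [Field K] [CommRing S] [Algebra K S]
    (𝒜 : ℕ → Submodule K S) [GradedAlgebra 𝒜] {I J : Ideal S}
    (hI : I.IsHomogeneous 𝒜) (hJ : J.IsHomogeneous 𝒜) (n : ℕ) :
    (I.restrictScalars K ⊔ J.restrictScalars K) ⊓ 𝒜 n ≤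
      I.restrictScalars K ⊔ J.restrictScalars K ⊓ 𝒜 n := by
  rintro x ⟨hx, hxn⟩
  obtain ⟨v, hv, w, hw, rfl⟩ := Submodule.mem_sup.mp hx
  have hdec := DirectSum.decompose_of_mem_same 𝒜 hxn
  rw [DirectSum.decompose_add, DirectSum.add_apply, Submodule.coe_add] at hdec
  rw [← hdec]
  exact Submodule.add_mem_sup (hI n hv) ⟨hJ n hw, SetLike.coe_mem _⟩

/-- Proposition 4.5 in graded form: if `S` is an ℕ-graded `K`-algebra, `I_V ∩ I_W = 0` are
homogeneous ideals, the graded pieces of `S/I_V` are finite-dimensional, the normalized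
dimensions of the graded pieces of `S/(I_V + I_W)` tend to `0` and those of `S/I_V` tend
to `d`, then the graded pieces of `I_W` are finite-dimensional and their normalized
dimensions tend to `d`. -/
theorem residual_ideal_degree {K S : Type*} [Field K] [CommRing S] [Algebra K S]
    (𝒜 : ℕ → Submodule K S) [GradedAlgebra 𝒜]
    (IV IW : Ideal S) (hVhom : IV.IsHomogeneous 𝒜) (hWhom : IW.IsHomogeneous 𝒜)
    (hdisj : IV ⊓ IW = ⊥) (r : ℕ) (hr : 1 ≤ r) (d : ℝ)
    (hfinV : ∀ n : ℕ,
      Module.Finite K ↥((𝒜 n).map (Ideal.Quotient.mkₐ K IV).toLinearMap))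
    (hVW : Tendsto (fun n : ℕ =>
        (r.factorial : ℝ) / (n : ℝ) ^ r *
          (Module.finrank K
            ↥((𝒜 n).map (Ideal.Quotient.mkₐ K (IV + IW)).toLinearMap) : ℝ))
      atTop (nhds 0))
    (hV : Tendsto (fun n : ℕ =>
        (r.factorial : ℝ) / (n : ℝ) ^ r *
          (Module.finrank K
            ↥((𝒜 n).map (Ideal.Quotient.mkₐ K IV).toLinearMap) : ℝ))
      atTop (nhds d)) :
    (∀ n : ℕ, Module.Finite K ↥(IW.restrictScalars K ⊓ 𝒜 n)) ∧
    Tendsto (fun n : ℕ =>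
        (r.factorial : ℝ) / (n : ℝ) ^ r *
          (Module.finrank K ↥(IW.restrictScalars K ⊓ 𝒜 n) : ℝ))
      atTop (nhds d) := by
  have key (n : ℕ) : Module.Finite K ↥(IW.restrictScalars K ⊓ 𝒜 n) ∧
      Module.finrank K ↥((𝒜 n).map (Ideal.Quotient.mkₐ K IV).toLinearMap) =
        Module.finrank K ↥((𝒜 n).map (Ideal.Quotient.mkₐ K (IV + IW)).toLinearMap) +
          Module.finrank K ↥(IW.restrictScalars K ⊓ 𝒜 n) := by
    have := hfinV n
    refine Submodule.finite_inf_and_finrank_map_eq (V := IV.restrictScalars K)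
      (Ideal.Quotient.mkₐ K IV).toLinearMap
      (Ideal.Quotient.factorₐ K (le_sup_left : IV ≤ IV + IW)).toLinearMap ?_ ?_ ?_
      (hVhom.sup_inf_le 𝒜 hWhom n)
    · ext x
      simp [Ideal.Quotient.eq_zero_iff_mem]
    · ext x
      rw [← Submodule.restrictScalars_sup]
      exact Ideal.Quotient.eq_zero_iff_mem
    · rw [← Submodule.restrictScalars_inf, hdisj, Submodule.restrictScalars_bot]
  refine ⟨fun n => (key n).1, ?_⟩
  have hlim := hV.sub hVW
  rw [sub_zero] at hlim
  refine hlim.congr fun n => ?_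
  rw [(key n).2]
  push_cast
  ring
end

section
/- Let k be an infinite field, R a reduced Noetherian commutative k-algebra, and M a finitely generated torsion-free R-module (every nonzerodivisor of R acts injectively on M) such that for each minimal prime p of R the localization M_p is a free R_p-module of rank e. Then there exists an injective R-linear map M → R^e whose localization at every minimal prime of R is an isomorphism. -/
theorem IsLocalizedModule.of_smul_eq_smul {R M N : Type*} [CommSemiring R] [AddCommMonoid M]
    [Module R M] [AddCommMonoid N] [Module R N] (S : Submonoid R) (f g : M →ₗ[R] N)
    [hf : IsLocalizedModule S f] (s t : S) (h : (s : R) • g = (t : R) • f) :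
    IsLocalizedModule S g := by
  obtain ⟨u, hu⟩ := hf.map_units s
  obtain ⟨v, hv⟩ := hf.map_units t
  have hg : g = (↑(u⁻¹ * v) : Module.End R N) ∘ₗ f := by
    have h' : (↑u : Module.End R N) ∘ₗ g = (↑v : Module.End R N) ∘ₗ f := by
      rw [hu, hv]; exact h
    calc g = (↑(u⁻¹ * u) : Module.End R N) ∘ₗ g := by simp [Module.End.one_eq_id]
      _ = _ := by
        rw [Units.val_mul, Units.val_mul, Module.End.mul_eq_comp, Module.End.mul_eq_comp,
          LinearMap.comp_assoc, h', LinearMap.comp_assoc]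
  rw [hg, IsLocalizedModule.comp_iff_of_bijective_left]
  · exact hf
  · exact (Module.End.isUnit_iff _).mp (u⁻¹ * v).isUnit

theorem LocalizedModule.map_bijective_of_isLocalizedModule_comp {R M N N' : Type*} [CommSemiring R]
    [AddCommMonoid M] [Module R M] [AddCommMonoid N] [Module R N] [AddCommMonoid N'] [Module R N']
    (S : Submonoid R) (f : M →ₗ[R] N) (g : N →ₗ[R] N') [IsLocalizedModule S g]
    [IsLocalizedModule S (g ∘ₗ f)] : Function.Bijective (LocalizedModule.map S f) := by
  have h : (IsLocalizedModule.iso S g).toLinearMap ∘ₗ (LocalizedModule.map S f).restrictScalars R =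
      (IsLocalizedModule.iso S (g ∘ₗ f)).toLinearMap := by
    apply IsLocalizedModule.linearMap_ext S (LocalizedModule.mkLinearMap S M) (g ∘ₗ f)
    ext x
    simp [LocalizedModule.map_mk, IsLocalizedModule.iso_apply_mk]
  have hb : Function.Bijective
      (IsLocalizedModule.iso S g ∘ LocalizedModule.map S f) := by
    convert (IsLocalizedModule.iso S (g ∘ₗ f)).bijective using 1
    exact congrArg DFunLike.coe h
  exact (Function.Bijective.of_comp_iff' (IsLocalizedModule.iso S g).bijective _).mp hb

/-- In a reduced ring with finitely many minimal primes, there is a family of pairwise orthogonal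
elements, each avoiding its own minimal prime. -/
theorem exists_notMem_minimalPrimes_mul_eq_zero {R : Type*} [CommRing R] [IsReduced R]
    (hfin : (minimalPrimes R).Finite) :
    ∃ s : minimalPrimes R → R, (∀ p, s p ∉ p.1) ∧ ∀ p q, p ≠ q → s p * s q = 0 := by
  classical
  have : Fintype (minimalPrimes R) := hfin.fintype
  have h (p : minimalPrimes R) : ∃ s ∉ p.1, ∀ q : minimalPrimes R, q ≠ p → s ∈ q.1 := by
    have hp : ¬ (Finset.univ.erase p).inf Subtype.val ≤ p.1 := by
      rw [p.2.isPrime.inf_le']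
      rintro ⟨q, hq, hqp⟩
      exact Finset.ne_of_mem_erase hq
        (Subtype.ext (hqp.antisymm (p.2.2 q.2.1 hqp)))
    obtain ⟨s, hs, hsp⟩ := SetLike.not_le_iff_exists.mp hp
    refine ⟨s, hsp, fun q hq ↦ ?_⟩
    exact Finset.inf_le (f := Subtype.val) (Finset.mem_erase.mpr ⟨hq, Finset.mem_univ q⟩) hs
  choose s hs hs' using h
  refine ⟨s, hs, fun p q hpq ↦ ?_⟩
  have hmem : s p * s q ∈ sInf (minimalPrimes R) := by
    refine Submodule.mem_sInf.mpr fun r hr ↦ ?_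
    by_cases h : (⟨r, hr⟩ : minimalPrimes R) = p
    · exact Ideal.mul_mem_left r _ (hs' q ⟨r, hr⟩ (h ▸ hpq))
    · exact Ideal.mul_mem_right _ r (hs' p ⟨r, hr⟩ h)
  simpa [minimalPrimes, Ideal.sInf_minimalPrimes, ← nilradical.eq_1, nilradical_eq_zero] using hmem

/-- An ideal of a reduced ring with finitely many minimal primes that lies in no minimal prime
contains a nonzerodivisor. -/
theorem Ideal.exists_mem_nonZeroDivisors_of_not_le_minimalPrimes {R : Type*} [CommRing R]
    [IsReduced R] (hfin : (minimalPrimes R).Finite) {I : Ideal R}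
    (hI : ∀ p ∈ minimalPrimes R, ¬ I ≤ p) : ∃ r ∈ I, r ∈ nonZeroDivisors R := by
  have h : ¬ (I : Set R) ⊆ ⋃ p ∈ minimalPrimes R, (p : Set R) := by
    intro hsub
    obtain ⟨p, hp, hle⟩ := (Ideal.subset_union_prime_finite hfin (f := id) ⊥ ⊥
      fun p hp _ _ ↦ hp.isPrime).mp hsub
    exact hI p hp hle
  obtain ⟨r, hrI, hr⟩ := Set.not_subset.mp h
  refine ⟨r, hrI, mem_nonZeroDivisors_iff_right.mpr fun x hx ↦ ?_⟩
  have hmem : x ∈ sInf (minimalPrimes R) := by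
    refine Submodule.mem_sInf.mpr fun p hp ↦ ?_
    refine (hp.isPrime.mem_or_mem (hx ▸ p.zero_mem)).resolve_right ?_
    exact fun hrp ↦ hr (Set.mem_biUnion hp hrp)
  simpa [minimalPrimes, Ideal.sInf_minimalPrimes, ← nilradical.eq_1, nilradical_eq_zero] using hmem

/-- The embedding claim from the proof of Proposition 3.1(iii): over an infinite field `k`,
a finitely generated torsion-free module `M` over a reduced Noetherian `k`-algebra `R`
which is free of rank `e` at every minimal prime embeds in `R^e` by a map which is an
isomorphism after localization at every minimal prime. -/
theorem embed_into_free_of_generic_rank {k : Type*} [Field k] [Infinite k]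
    {R : Type*} [CommRing R] [IsReduced R] [IsNoetherianRing R] [Algebra k R]
    {M : Type*} [AddCommGroup M] [Module R M] [Module.Finite R M]
    (htf : ∀ r ∈ nonZeroDivisors R, ∀ x : M, r • x = 0 → x = 0)
    (e : ℕ)
    (hfree : ∀ (p : Ideal R) [p.IsPrime], p ∈ minimalPrimes R →
      Nonempty (LocalizedModule p.primeCompl M ≃ₗ[Localization p.primeCompl]
        (Fin e → Localization p.primeCompl))) :
    ∃ f : M →ₗ[R] (Fin e → R), Function.Injective f ∧
      ∀ (p : Ideal R) [p.IsPrime], p ∈ minimalPrimes R →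
        Function.Bijective (LocalizedModule.map p.primeCompl f) := by
  classical
  have hfin : (minimalPrimes R).Finite := minimalPrimes.finite_of_isNoetherianRing R
  have := Module.finitePresentation_of_finite R M
  have : Fintype (minimalPrimes R) := hfin.fintype
  have (p : minimalPrimes R) : p.1.IsPrime := p.2.isPrime
  obtain ⟨s, hs, hs0⟩ := exists_notMem_minimalPrimes_mul_eq_zero hfin
  let ι (p : minimalPrimes R) : (Fin e → R) →ₗ[R] (Fin e → Localization p.1.primeCompl) :=
    (Algebra.linearMap R (Localization p.1.primeCompl)).compLeft (Fin e)
  have hι (p : minimalPrimes R) : IsLocalizedModule p.1.primeCompl (ι p) :=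
    inferInstanceAs (IsLocalizedModule p.1.primeCompl
      (LinearMap.pi fun i ↦ Algebra.linearMap R (Localization p.1.primeCompl) ∘ₗ LinearMap.proj i))
  have hlocal (p : minimalPrimes R) : ∃ g : M →ₗ[R] (Fin e → R),
      IsLocalizedModule p.1.primeCompl (ι p ∘ₗ g) := by
    obtain ⟨E⟩ := hfree p.1 p.2
    let φ := (E.restrictScalars R).toLinearMap ∘ₗ LocalizedModule.mkLinearMap p.1.primeCompl M
    obtain ⟨g, t, hg⟩ := Module.FinitePresentation.exists_lift_of_isLocalizedModule
      p.1.primeCompl (ι p) φ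
    exact ⟨g, .of_smul_eq_smul _ φ _ 1 t (by rw [hg]; simp; rfl)⟩
  choose g hg using hlocal
  let f := ∑ p, s p • g p
  have hsf (p : minimalPrimes R) : s p • f = (s p * s p) • g p := by
    simp only [f, Finset.smul_sum, smul_smul]
    exact Finset.sum_eq_single p (fun q _ hqp ↦ by rw [hs0 p q hqp.symm, zero_smul]) (by simp)
  have hf (p : minimalPrimes R) : IsLocalizedModule p.1.primeCompl (ι p ∘ₗ f) := by
    let u : p.1.primeCompl := ⟨s p, hs p⟩
    refine .of_smul_eq_smul _ (ι p ∘ₗ g p) _ u (u * u) ?_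
    rw [← LinearMap.comp_smul, ← LinearMap.comp_smul]
    exact congrArg _ (hsf p)
  refine ⟨f, (injective_iff_map_eq_zero f).mpr fun x hx ↦ ?_, fun p _ hp ↦ ?_⟩
  · obtain ⟨r, hr, hr0⟩ := Ideal.exists_mem_nonZeroDivisors_of_not_le_minimalPrimes hfin
      (I := Ideal.torsionOf R M x) fun p hp hle ↦ by
        have := hp.isPrime
        have := hf ⟨p, hp⟩
        obtain ⟨t, ht⟩ := (IsLocalizedModule.eq_zero_iff p.primeCompl (ι ⟨p, hp⟩ ∘ₗ f)).mp
          (show (ι ⟨p, hp⟩ ∘ₗ f) x = 0 by simp [hx])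
        exact t.2 (hle ht)
    exact htf r hr0 x hr
  · have := hι ⟨p, hp⟩
    have := hf ⟨p, hp⟩
    exact LocalizedModule.map_bijective_of_isLocalizedModule_comp _ f (ι ⟨p, hp⟩)
end
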